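/- Uniform bound for the spectral projections of a bounded group: Let A be the generator of a bounded C₀-group T with ‖T(t)‖ ≤ M, let μ be a nonzero real number such that iμ is an isolated point of σ(A), and let P := (1/(2πi)) ∮_{|λ−iμ|=r} (λ − A)⁻¹ dλ be the associated Riesz projection (r > 0 small enough that the closed disc of centre iμ and radius r meets σ(A) only at iμ). Then ‖P‖ ≤ 2M; moreover P(E) ⊆ D(A) and ‖Px‖ ≤ (2M/|μ|)·‖Ax‖ for every x ∈ D(A). -/

import Mathlib

open MeasureTheory Complex Filter Topology Metric

namespace SpectralDecomp

variable {G : Type*} [NormedAddCommGroup G] [NormedSpace ℂ G]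

/-- `R` is the bounded inverse of `z • I - A`. -/
structure ResolventAt (A : G →ₗ.[ℂ] G) (z : ℂ) (R : G →L[ℂ] G) : Prop where
  mem : ∀ y : G, R y ∈ A.domain
  solves : ∀ y : G, z • R y - A ⟨R y, mem y⟩ = y
  leftInv : ∀ x : A.domain, R (z • (x : G) - A x) = x

/-- The resolvent set of the (unbounded) operator `A`. -/
def resolventSet (A : G →ₗ.[ℂ] G) : Set ℂ :=
  {z : ℂ | ∃ R : G →L[ℂ] G, ResolventAt A z R}

/-- The spectrum of the (unbounded) operator `A`. -/
def spectrumSet (A : G →ₗ.[ℂ] G) : Set ℂ := (resolventSet A)ᶜ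

/-- Membership in the domain of `A ^ j`. -/
def InDomPow (A : G →ₗ.[ℂ] G) : ℕ → G → Prop
  | 0, _ => True
  | j + 1, x => ∃ h : x ∈ A.domain, InDomPow A j (A ⟨x, h⟩)

/-- The value `A ^ j x` for `x ∈ D(A ^ j)`. -/
noncomputable def powApply (A : G →ₗ.[ℂ] G) : (j : ℕ) → (x : G) → InDomPow A j x → G
  | 0, x, _ => x
  | j + 1, x, h => powApply A j (A ⟨x, h.choose⟩) h.choose_spec

/-- `A` generates an `n`-times integrated group `(Sp, Sm)` bounded by `M * (1 + |t| ^ m)`. -/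
def Generates (A : G →ₗ.[ℂ] G) (n m : ℕ) (M : ℝ) (Sp Sm : ℝ → G →L[ℂ] G) : Prop :=
  (∀ x : G, ContinuousOn (fun t : ℝ => Sp t x) (Set.Ici 0)) ∧
  (∀ x : G, ContinuousOn (fun t : ℝ => Sm t x) (Set.Ici 0)) ∧
  (∀ t : ℝ, 0 ≤ t → ‖Sp t‖ ≤ M * (1 + t ^ m)) ∧
  (∀ t : ℝ, 0 ≤ t → ‖Sm t‖ ≤ M * (1 + t ^ m)) ∧
  (∀ z : ℂ, 0 < z.re →
    (∃ R : G →L[ℂ] G, ResolventAt A z R ∧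
      ∀ x : G, R x = z ^ n • ∫ t in Set.Ioi (0 : ℝ), Complex.exp (-z * t) • Sp t x) ∧
    (∃ R : G →L[ℂ] G, ResolventAt A (-z) R ∧
      ∀ x : G, -(R x) = z ^ n • ∫ t in Set.Ioi (0 : ℝ), Complex.exp (-z * t) • Sm t x))

/-- The Riesz projection associated to the circle of centre `c` and radius `ρ`,
built from the resolvent function `Rres`. -/
noncomputable def rieszProj (Rres : ℂ → G →L[ℂ] G) (c : ℂ) (ρ : ℝ) : G →L[ℂ] G :=
  (2 * Real.pi * Complex.I)⁻¹ • (∮ z in C(c, ρ), Rres z)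

/-- The resolvent identity. -/
theorem ResolventAt.sub_eq {A : G →ₗ.[ℂ] G} {z w : ℂ} {R S : G →L[ℂ] G}
    (hR : ResolventAt A z R) (hS : ResolventAt A w S) : R - S = (w - z) • (R * S) := by
  ext y
  have h1 := hR.leftInv ⟨S y, hS.mem y⟩
  have h2 := hS.solves y
  have h3 : z • S y - A ⟨S y, hS.mem y⟩ = (z - w) • S y + y := by
    calc _ = (z - w) • S y + (w • S y - A ⟨S y, hS.mem y⟩) := by module
      _ = _ := by rw [h2]
  simp only at h1
  rw [h3, map_add, map_smul] at h1
  simp only [sub_apply, smul_apply,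
    mul_apply_eq_comp]
  nth_rewrite 1 [← h1]
  module

theorem ResolventAt.commute {A : G →ₗ.[ℂ] G} {z w : ℂ} {R S : G →L[ℂ] G}
    (hR : ResolventAt A z R) (hS : ResolventAt A w S) : Commute R S := by
  rcases eq_or_ne z w with rfl | h
  · have := hR.sub_eq hS
    rw [sub_self, zero_smul, sub_eq_zero] at this
    exact this ▸ Commute.refl R
  · have h1 := hR.sub_eq hS
    have h2 := hS.sub_eq hR
    have h3 : (w - z) • (R * S) = (w - z) • (S * R) := by
      rw [← h1, ← neg_sub S R, h2, ← neg_smul, neg_sub]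
    exact smul_right_injective _ (sub_ne_zero.mpr h.symm) h3

section Resolvent

variable {A : G →ₗ.[ℂ] G} {Rres : ℂ → G →L[ℂ] G}

theorem norm_resolvent_le_two_mul (hres : ∀ z ∈ resolventSet A, ResolventAt A z (Rres z))
    {z w : ℂ} (hz : z ∈ resolventSet A) (hw : w ∈ resolventSet A)
    (h : ‖w - z‖ * ‖Rres w‖ ≤ 1 / 2) : ‖Rres z‖ ≤ 2 * ‖Rres w‖ := by
  have h1 := (hres z hz).sub_eq (hres w hw)
  have h2 : ‖Rres z‖ ≤ ‖Rres w‖ + ‖w - z‖ * (‖Rres z‖ * ‖Rres w‖) := by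
    calc ‖Rres z‖ = ‖Rres w + (w - z) • (Rres z * Rres w)‖ := by rw [← h1]; congr 1; abel
      _ ≤ _ := (norm_add_le _ _).trans (by
        rw [norm_smul]; gcongr; exact norm_mul_le _ _)
  nlinarith [norm_nonneg (Rres z)]

theorem continuousOn_resolvent (hres : ∀ z ∈ resolventSet A, ResolventAt A z (Rres z)) :
    ContinuousOn Rres (resolventSet A) := by
  intro w hw
  have hlim : Tendsto (fun z : ℂ => ‖w - z‖ * ‖Rres w‖) (𝓝[resolventSet A] w) (𝓝 0) := by
    have : Continuous fun z : ℂ => ‖w - z‖ * ‖Rres w‖ := by fun_prop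
    simpa using (this.tendsto w).mono_left nhdsWithin_le_nhds
  refine tendsto_iff_norm_sub_tendsto_zero.mpr ?_
  refine squeeze_zero' (Eventually.of_forall fun _ => norm_nonneg _) ?_
    (by simpa using hlim.mul_const (2 * ‖Rres w‖))
  filter_upwards [self_mem_nhdsWithin, hlim.eventually_le_const (by norm_num : (0 : ℝ) < 1 / 2)]
    with z hz hz2
  rw [(hres z hz).sub_eq (hres w hw), norm_smul, mul_assoc]
  gcongr
  refine (norm_mul_le _ _).trans ?_
  rw [mul_comm]
  gcongr
  exact norm_resolvent_le_two_mul hres hz hw hz2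

theorem differentiableAt_resolvent (hres : ∀ z ∈ resolventSet A, ResolventAt A z (Rres z))
    {w : ℂ} (hw : resolventSet A ∈ 𝓝 w) : DifferentiableAt ℂ Rres w := by
  have hcont : Tendsto Rres (𝓝[≠] w) (𝓝 (Rres w)) :=
    ((continuousOn_resolvent hres).continuousAt hw).tendsto.mono_left nhdsWithin_le_nhds
  have hlim : Tendsto (fun z => -(Rres z * Rres w)) (𝓝[≠] w) (𝓝 (-(Rres w * Rres w))) :=
    (hcont.mul_const _).neg
  refine (hasDerivAt_iff_tendsto_slope.mpr (hlim.congr' ?_)).differentiableAt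
  filter_upwards [self_mem_nhdsWithin, mem_nhdsWithin_of_mem_nhds hw] with z hz hz2
  rw [slope_def_module, (hres z hz2).sub_eq (hres w (mem_of_mem_nhds hw)), smul_smul,
    ← neg_sub z w, mul_neg, inv_mul_cancel₀ (sub_ne_zero.mpr hz), neg_one_smul]

end Resolvent

theorem _root_.ContinuousLinearMap.circleIntegrable_comp {F H : Type*}
    [NormedAddCommGroup F] [NormedSpace ℂ F] [NormedAddCommGroup H] [NormedSpace ℂ H]
    (L : F →L[ℂ] H) {f : ℂ → F} {c : ℂ} {R : ℝ} (hf : CircleIntegrable f c R) :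
    CircleIntegrable (fun z => L (f z)) c R :=
  ⟨L.integrable_comp hf.1, L.integrable_comp hf.2⟩

theorem _root_.ContinuousLinearMap.circleIntegral_comp_comm {F H : Type*}
    [NormedAddCommGroup F] [NormedSpace ℂ F] [CompleteSpace F]
    [NormedAddCommGroup H] [NormedSpace ℂ H] [CompleteSpace H] (L : F →L[ℂ] H)
    {f : ℂ → F} {c : ℂ} {R : ℝ} (hf : CircleIntegrable f c R) :
    (∮ z in C(c, R), L (f z)) = L (∮ z in C(c, R), f z) := by
  simp only [circleIntegral, ← map_smul]
  exact L.intervalIntegral_comp_comm hf.out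

section Group

variable {U : ℝ → G →L[ℂ] G} {M : ℝ}

theorem hasDerivAt_orbit (hUmul : ∀ s t : ℝ, U (s + t) = U s ∘L U t) {x w : G}
    (h : Tendsto (fun t : ℝ => ((t : ℂ))⁻¹ • (U t x - x)) (𝓝[≠] 0) (𝓝 w)) (t : ℝ) :
    HasDerivAt (fun s : ℝ => U s x) (U t w) t := by
  rw [hasDerivAt_iff_tendsto_slope_zero]
  refine (((U t).continuous.tendsto w).comp h).congr fun s => ?_
  simp only [Function.comp_apply, hUmul, ContinuousLinearMap.comp_apply]
  rw [map_smul, map_sub, ← Complex.ofReal_inv, Complex.coe_smul]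

/-- The Laplace transform estimate for a bounded orbit, in resolvent form. -/
theorem re_mul_norm_le_of_orbit (hU0 : U 0 = 1) (hUbd : ∀ t, ‖U t‖ ≤ M) {x w : G}
    (hder : ∀ t, HasDerivAt (fun s : ℝ => U s x) (U t w) t) {z : ℂ} (hz : 0 < z.re) :
    z.re * ‖x‖ ≤ M * ‖z • x - w‖ := by
  set y := z • x - w with hy
  have hM : 0 ≤ M := (norm_nonneg _).trans (hUbd 0)
  have hexp : ∀ t : ℝ, HasDerivAt (fun s : ℝ => Complex.exp (-z * s))
      (Complex.exp (-z * t) * -z) t :=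
    fun t => by
      have h1 : HasDerivAt (fun s : ℝ => -z * (s : ℂ)) (-z) t := by
        simpa using (Complex.ofRealCLM.hasDerivAt (x := t)).const_mul (-z)
      exact h1.cexp
  have hnexp : ∀ t : ℝ, ‖Complex.exp (-z * t)‖ = Real.exp (-z.re * t) := fun t => by
    simp [Complex.norm_exp]
  have hf : ∀ t : ℝ, HasDerivAt (fun s : ℝ => Complex.exp (-z * s) • U s x - x)
      (-(Complex.exp (-z * t) • U t y)) t := fun t => by
    refine (((hexp t).smul (hder t)).sub_const x).congr_deriv ?_
    rw [hy, map_sub, map_smul]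
    module
  have hB : ∀ t : ℝ, HasDerivAt (fun s : ℝ => M * ‖y‖ / z.re * (1 - Real.exp (-z.re * s)))
      (M * ‖y‖ * Real.exp (-z.re * t)) t := fun t => by
    have h1 : HasDerivAt (fun s : ℝ => -z.re * s) (-z.re) t := by
      simpa using (hasDerivAt_id t).const_mul (-z.re)
    refine ((h1.exp.const_sub 1).const_mul (M * ‖y‖ / z.re)).congr_deriv ?_
    field_simp
  have key : ∀ t : ℝ, 0 ≤ t →
      ‖x‖ ≤ M * ‖y‖ / z.re + Real.exp (-z.re * t) * (M * ‖x‖) := fun t ht => by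
    have h1 := image_norm_le_of_norm_deriv_right_le_deriv_boundary (a := 0) (b := t)
      (fun s _ => (hf s).continuousAt.continuousWithinAt) (fun s _ => (hf s).hasDerivWithinAt)
      (by simp [hU0]) hB (fun s _ => by
        rw [norm_neg, norm_smul, hnexp, mul_comm]
        gcongr
        exact (U s).le_of_opNorm_le (hUbd s) y) (Set.right_mem_Icc.mpr ht)
    have h2 : ‖Complex.exp (-z * t) • U t x‖ ≤ Real.exp (-z.re * t) * (M * ‖x‖) := by
      rw [norm_smul, hnexp]
      gcongr
      exact (U t).le_of_opNorm_le (hUbd t) x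
    have h3 : M * ‖y‖ / z.re * (1 - Real.exp (-z.re * t)) ≤ M * ‖y‖ / z.re :=
      mul_le_of_le_one_right (by positivity) (by linarith [Real.exp_pos (-z.re * t)])
    have h4 := norm_sub_norm_le x (Complex.exp (-z * t) • U t x)
    rw [norm_sub_rev] at h4
    linarith
  have hlim : Tendsto (fun t : ℝ => M * ‖y‖ / z.re + Real.exp (-z.re * t) * (M * ‖x‖)) atTop
      (𝓝 (M * ‖y‖ / z.re + 0 * (M * ‖x‖))) := by
    refine (Tendsto.mul_const _ ?_).const_add _
    exact Real.tendsto_exp_atBot.comp (tendsto_id.const_mul_atTop_of_neg (by linarith))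
  have h := ge_of_tendsto hlim ((eventually_ge_atTop 0).mono key)
  rw [zero_mul, add_zero, le_div_iff₀ hz] at h
  linarith

theorem abs_re_mul_norm_resolvent_le {T : ℝ → G →L[ℂ] G} (hT0 : T 0 = 1)
    (hTmul : ∀ s t : ℝ, T (s + t) = T s ∘L T t) (hTbd : ∀ t : ℝ, ‖T t‖ ≤ M)
    {A : G →ₗ.[ℂ] G}
    (hgen : ∀ x y : G, (∃ hx : x ∈ A.domain, A ⟨x, hx⟩ = y) →
      Tendsto (fun t : ℝ => ((t : ℂ))⁻¹ • (T t x - x)) (𝓝[≠] 0) (𝓝 y))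
    {z : ℂ} {R : G →L[ℂ] G} (hR : ResolventAt A z R) : |z.re| * ‖R‖ ≤ M := by
  have hM : 0 ≤ M := (norm_nonneg _).trans (hTbd 0)
  rcases eq_or_ne z.re 0 with h0 | h0
  · simpa [h0] using hM
  rw [mul_comm, ← le_div_iff₀ (abs_pos.mpr h0)]
  refine R.opNorm_le_bound (by positivity) fun y => ?_
  rw [div_mul_eq_mul_div, le_div_iff₀ (abs_pos.mpr h0), mul_comm]
  have hder := hasDerivAt_orbit hTmul (hgen (R y) _ ⟨hR.mem y, rfl⟩)
  have hy := hR.solves y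
  rcases lt_or_gt_of_ne h0 with hneg | hpos
  · have h := re_mul_norm_le_of_orbit (U := fun t => T (-t)) (x := R y)
      (w := -A ⟨R y, hR.mem y⟩) (z := -z) (by simpa using hT0) (fun t => hTbd (-t))
      (fun t => by simpa [Function.comp_def] using (hder (-t)).scomp t (hasDerivAt_neg t))
      (by simpa using hneg)
    have h2 : -z • R y - -A ⟨R y, hR.mem y⟩ = -y := by
      calc _ = -(z • R y - A ⟨R y, hR.mem y⟩) := by module
        _ = -y := by rw [hy]
    rwa [h2, norm_neg, Complex.neg_re, ← abs_of_neg hneg] at h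
  · have h := re_mul_norm_le_of_orbit hT0 hTbd hder hpos
    rwa [hy, ← abs_of_pos hpos] at h

end Group

/-- On the circle `‖u‖ = s` the weight `s ^ 2 + u ^ 2` has modulus `2 * s * |u.re|`. -/
theorem norm_sq_add_sq (u : ℂ) : ‖((‖u‖ : ℂ)) ^ 2 + u ^ 2‖ = 2 * ‖u‖ * |u.re| := by
  have h : ((‖u‖ : ℂ)) ^ 2 + u ^ 2 = u * ((2 * u.re : ℝ) : ℂ) := by
    rw [← Complex.mul_conj', ← Complex.add_conj]
    ring
  rw [h, norm_mul, Complex.norm_real, norm_mul]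
  simp
  ring

section Laurent

variable {F : Type*} [NormedAddCommGroup F] [NormedSpace ℂ F]
  {f : ℂ → F} {c : ℂ} {r M : ℝ}

/-- The moment `∮ (z - c) ^ k f(z) dz`, a Laurent coefficient of `f` up to the factor `2πi`. -/
noncomputable def moment (f : ℂ → F) (c : ℂ) (k : ℤ) (s : ℝ) : F :=
  ∮ z in C(c, s), (z - c) ^ k • f z

theorem continuousOn_zpow_smul (hf : ContinuousOn f (closedBall c r \ {c})) (k : ℤ) :
    ContinuousOn (fun z => (z - c) ^ k • f z) (closedBall c r \ {c}) := by
  refine ContinuousOn.smul (ContinuousOn.zpow₀ (by fun_prop) k fun z hz => ?_) hf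
  exact Or.inl (sub_ne_zero.mpr hz.2)

theorem circleIntegrable_zpow_smul (hf : ContinuousOn f (closedBall c r \ {c})) (k : ℤ)
    {s : ℝ} (hs : 0 < s) (hsr : s ≤ r) :
    CircleIntegrable (fun z => (z - c) ^ k • f z) c s :=
  ((continuousOn_zpow_smul hf k).mono fun _ hz =>
    ⟨closedBall_subset_closedBall hsr (sphere_subset_closedBall hz),
      ne_of_mem_sphere hz hs.ne'⟩).circleIntegrable hs.le

theorem moment_eq [CompleteSpace F] (hf : ContinuousOn f (closedBall c r \ {c}))
    (hd : ∀ z ∈ ball c r \ {c}, DifferentiableAt ℂ f z) (k : ℤ)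
    {s : ℝ} (hs : 0 < s) (hsr : s ≤ r) : moment f c k r = moment f c k s := by
  refine circleIntegral_eq_of_differentiable_on_annulus_off_countable hs hsr
    Set.countable_empty ((continuousOn_zpow_smul hf k).mono fun z hz => ⟨hz.1, ?_⟩) ?_
  · rintro rfl
    exact hz.2 (mem_ball_self hs)
  · rintro z ⟨⟨hz1, hz2⟩, -⟩
    have hzc : z ≠ c := by
      rintro rfl
      exact hz2 (mem_closedBall_self hs.le)
    refine DifferentiableAt.smul (DifferentiableAt.zpow (by fun_prop) ?_) (hd z ⟨hz1, hzc⟩)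
    exact Or.inl (sub_ne_zero.mpr hzc)

theorem norm_moment_add_moment_le [CompleteSpace F]
    (hf : ContinuousOn f (closedBall c r \ {c}))
    (hd : ∀ z ∈ ball c r \ {c}, DifferentiableAt ℂ f z)
    (hM : ∀ z ∈ closedBall c r \ {c}, |(z - c).re| * ‖f z‖ ≤ M) (k : ℤ)
    {s : ℝ} (hs : 0 < s) (hsr : s ≤ r) :
    ‖(s : ℂ) ^ 2 • moment f c k r + moment f c (k + 2) r‖ ≤ 4 * Real.pi * M * s ^ (k + 2) := by
  have hf_int := fun k => circleIntegrable_zpow_smul hf k hs hsr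
  rw [moment_eq hf hd k hs hsr, moment_eq hf hd (k + 2) hs hsr, moment, moment,
    ← circleIntegral.integral_smul, ← circleIntegral.integral_add
      (f := fun z => (s : ℂ) ^ 2 • (z - c) ^ k • f z)
      ((hf_int k).continuousOn_smul continuousOn_const) (hf_int (k + 2))]
  refine (circleIntegral.norm_integral_le_of_norm_le_const (C := s ^ k * (2 * s) * M) hs.le
    fun z hz => ?_).trans_eq ?_
  · have hzc : z ≠ c := ne_of_mem_sphere hz hs.ne'
    have hns : ‖z - c‖ = s := mem_sphere_iff_norm.mp hz
    have h1 : (s : ℂ) ^ 2 • (z - c) ^ k • f z + (z - c) ^ (k + 2) • f z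
        = ((z - c) ^ k * ((s : ℂ) ^ 2 + (z - c) ^ 2)) • f z := by
      rw [zpow_add₀ (sub_ne_zero.mpr hzc), smul_smul, ← add_smul, zpow_ofNat]
      ring_nf
    have h2 := norm_sq_add_sq (z - c)
    rw [hns] at h2
    have h3 := hM z ⟨closedBall_subset_closedBall hsr (sphere_subset_closedBall hz), hzc⟩
    rw [h1, norm_smul, norm_mul, norm_zpow, hns, h2, mul_assoc, mul_assoc, mul_assoc (s ^ k)]
    gcongr
  · rw [zpow_add₀ hs.ne', zpow_ofNat]
    ring

theorem moment_eq_zero [CompleteSpace F] (hr : 0 < r)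
    (hf : ContinuousOn f (closedBall c r \ {c}))
    (hd : ∀ z ∈ ball c r \ {c}, DifferentiableAt ℂ f z)
    (hM : ∀ z ∈ closedBall c r \ {c}, |(z - c).re| * ‖f z‖ ≤ M) {n : ℕ} (hn : n ≠ 0) :
    moment f c n r = 0 := by
  have hlim : Tendsto (fun s : ℝ => ‖(s : ℂ) ^ 2 • moment f c (n - 2) r + moment f c n r‖)
      (𝓝[>] 0) (𝓝 ‖moment f c n r‖) := by
    have : Continuous fun s : ℝ => ‖(s : ℂ) ^ 2 • moment f c (n - 2) r + moment f c n r‖ := by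
      fun_prop
    simpa using (this.tendsto 0).mono_left nhdsWithin_le_nhds
  have hlim' : Tendsto (fun s : ℝ => 4 * Real.pi * M * s ^ n) (𝓝[>] 0) (𝓝 0) := by
    have : Continuous fun s : ℝ => 4 * Real.pi * M * s ^ n := by fun_prop
    simpa [hn] using (this.tendsto 0).mono_left nhdsWithin_le_nhds
  refine norm_le_zero_iff.mp (le_of_tendsto_of_tendsto hlim hlim' ?_)
  filter_upwards [Ioc_mem_nhdsGT hr] with s hs
  simpa using norm_moment_add_moment_le hf hd hM (n - 2) hs.1 hs.2

theorem norm_moment_zero_le [CompleteSpace F] (hr : 0 < r)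
    (hf : ContinuousOn f (closedBall c r \ {c}))
    (hd : ∀ z ∈ ball c r \ {c}, DifferentiableAt ℂ f z)
    (hM : ∀ z ∈ closedBall c r \ {c}, |(z - c).re| * ‖f z‖ ≤ M) :
    ‖moment f c 0 r‖ ≤ 4 * Real.pi * M := by
  have h := norm_moment_add_moment_le hf hd hM 0 hr le_rfl
  have h2 := moment_eq_zero hr hf hd hM two_ne_zero
  norm_num at h h2
  rw [h2, add_zero, norm_smul, norm_pow, Complex.norm_real, Real.norm_of_nonneg hr.le,
    mul_comm] at h
  exact le_of_mul_le_mul_right h (by positivity)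

end Laurent

/-- Uniform bound for the spectral projections of a bounded `C₀`-group: if `A`
generates the bounded `C₀`-group `T` with `‖T t‖ ≤ M`, `μ ≠ 0` is real with
`iμ` an isolated point of `σ(A)`, and `P` is the associated Riesz projection,
then `‖P‖ ≤ 2M`, `P(E) ⊆ D(A)`, and `‖P x‖ ≤ (2M/|μ|) ‖A x‖` for `x ∈ D(A)`. -/
theorem rieszProj_bound_bounded_group
    {E : Type*} [NormedAddCommGroup E] [NormedSpace ℂ E] [CompleteSpace E]
    (T : ℝ → E →L[ℂ] E) (M : ℝ)
    (hT0 : T 0 = 1) (hTmul : ∀ s t : ℝ, T (s + t) = T s ∘L T t)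
    (hTcont : ∀ x : E, Continuous fun t : ℝ => T t x)
    (hTbd : ∀ t : ℝ, ‖T t‖ ≤ M)
    (A : E →ₗ.[ℂ] E)
    (hgen : ∀ x y : E, (∃ hx : x ∈ A.domain, A ⟨x, hx⟩ = y) ↔
      Filter.Tendsto (fun t : ℝ => ((t : ℂ))⁻¹ • (T t x - x))
        (nhdsWithin 0 {(0 : ℝ)}ᶜ) (nhds y))
    (Rres : ℂ → E →L[ℂ] E)
    (hres : ∀ z ∈ resolventSet A, ResolventAt A z (Rres z))
    (μ : ℝ) (hμ : μ ≠ 0) (hμspec : (Complex.I * (μ : ℂ)) ∈ spectrumSet A)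
    (r : ℝ) (hr : 0 < r)
    (hrsep : ∀ z ∈ spectrumSet A,
      z ∈ Metric.closedBall (Complex.I * (μ : ℂ)) r → z = Complex.I * (μ : ℂ)) :
    ‖rieszProj Rres (Complex.I * (μ : ℂ)) r‖ ≤ 2 * M ∧
    (∀ x : E, rieszProj Rres (Complex.I * (μ : ℂ)) r x ∈ A.domain) ∧
    (∀ (x : E) (hx : x ∈ A.domain),
      ‖rieszProj Rres (Complex.I * (μ : ℂ)) r x‖ ≤ (2 * M / |μ|) * ‖A ⟨x, hx⟩‖) := by
  set c : ℂ := Complex.I * (μ : ℂ) with hc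
  have hcre : c.re = 0 := by simp [hc]
  have hcn : ‖c‖ = |μ| := by simp [hc]
  have hsub : closedBall c r \ {c} ⊆ resolventSet A := fun z hz => by
    by_contra h
    exact hz.2 (hrsep z h hz.1)
  have hf : ContinuousOn Rres (closedBall c r \ {c}) := (continuousOn_resolvent hres).mono hsub
  have hd : ∀ z ∈ ball c r \ {c}, DifferentiableAt ℂ Rres z := fun z hz =>
    differentiableAt_resolvent hres <| mem_of_superset
      ((isOpen_ball.sdiff isClosed_singleton).mem_nhds hz)
      ((Set.sdiff_subset_sdiff_left ball_subset_closedBall).trans hsub)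
  have hM : ∀ z ∈ closedBall c r \ {c}, |(z - c).re| * ‖Rres z‖ ≤ M := fun z hz => by
    rw [Complex.sub_re, hcre, sub_zero]
    exact abs_re_mul_norm_resolvent_le hT0 hTmul hTbd (fun x y => (hgen x y).mp)
      (hres z (hsub hz))
  set J : E →L[ℂ] E := ∮ z in C(c, r), Rres z with hJ
  have hJ0 : moment Rres c 0 r = J := by simp [moment, hJ]
  have hJ1 : (∮ z in C(c, r), (z - c) • Rres z) = 0 := by
    simpa [moment] using moment_eq_zero hr hf hd hM one_ne_zero
  have hbound : ‖rieszProj Rres c r‖ ≤ 2 * M := by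
    have h := norm_moment_zero_le hr hf hd hM
    rw [hJ0] at h
    rw [rieszProj, ← hJ, norm_smul, norm_inv]
    simp only [norm_mul, Complex.norm_real, Complex.norm_I, Complex.norm_ofNat, mul_one,
      Real.norm_of_nonneg Real.pi_pos.le]
    rw [inv_mul_le_iff₀ (by positivity)]
    linarith
  set w : ℂ := c + r with hw
  have hwmem : w ∈ resolventSet A := hsub ⟨by simp [hw, abs_of_pos hr], by simp [hw, hr.ne']⟩
  have hRw := hres w hwmem
  have hf_int : CircleIntegrable Rres c r := by
    simpa using circleIntegrable_zpow_smul hf 0 hr le_rfl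
  have hf_int1 : CircleIntegrable (fun z => (z - c) • Rres z) c r := by
    simpa using circleIntegrable_zpow_smul hf 1 hr le_rfl
  let L : (E →L[ℂ] E) →L[ℂ] (E →L[ℂ] E) := (ContinuousLinearMap.mul ℂ (E →L[ℂ] E)).flip (Rres w)
  have hconst : (∮ _z in C(c, r), Rres w) = 0 :=
    circleIntegral.integral_eq_zero_of_hasDerivWithinAt (f := fun z : ℂ => z • Rres w) hr.le
      fun z _ => by simpa using ((hasDerivAt_id z).smul_const (Rres w)).hasDerivWithinAt
  have hJS : J = (w - c) • (J * Rres w) := by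
    let L₁ : (E →L[ℂ] E) →L[ℂ] (E →L[ℂ] E) := ContinuousLinearMap.id ℂ _ - (w - c) • L
    have h1 : (∮ z in C(c, r), (L₁ (Rres z) + L ((z - c) • Rres z))) = 0 := by
      rw [← hconst]
      refine circleIntegral.integral_congr hr.le fun z hz => ?_
      have h := (hres z (hsub ⟨sphere_subset_closedBall hz, ne_of_mem_sphere hz hr.ne'⟩)).sub_eq hRw
      have h2 : Rres z = Rres w + (w - z) • (Rres z * Rres w) := by rw [← h]; abel
      simp only [L₁, L, sub_apply, ContinuousLinearMap.id_apply,
        smul_apply, ContinuousLinearMap.flip_apply,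
        ContinuousLinearMap.mul_apply', smul_mul_assoc]
      nth_rewrite 1 [h2]
      module
    rw [circleIntegral.integral_add (L₁.circleIntegrable_comp hf_int)
      (L.circleIntegrable_comp hf_int1), L₁.circleIntegral_comp_comm hf_int,
      L.circleIntegral_comp_comm hf_int1, hJ1, map_zero, add_zero] at h1
    exact sub_eq_zero.mp h1
  have hcomm : J * Rres w = Rres w * J := by
    have h1 := L.circleIntegral_comp_comm hf_int
    have h2 := (ContinuousLinearMap.mul ℂ (E →L[ℂ] E) (Rres w)).circleIntegral_comp_comm hf_int
    rw [← hJ] at h1 h2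
    refine h1.symm.trans (Eq.trans ?_ h2)
    refine circleIntegral.integral_congr hr.le fun z hz => ?_
    exact (hres z (hsub ⟨sphere_subset_closedBall hz, ne_of_mem_sphere hz hr.ne'⟩)).commute hRw
  set P : E →L[ℂ] E := rieszProj Rres c r with hP
  have hPJ : P = (2 * Real.pi * Complex.I)⁻¹ • J := rfl
  have hPS : P = (w - c) • (P * Rres w) := by
    rw [hPJ, smul_mul_assoc, smul_comm, ← hJS]
  have hSP : P = (w - c) • (Rres w * P) := by
    rw [hPJ, mul_smul_comm, smul_comm, ← hcomm, ← hJS]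
  refine ⟨hbound, fun x => ?_, fun x hx => ?_⟩
  · rw [hSP]
    exact A.domain.smul_mem _ (hRw.mem (P x))
  · have h1 : P (w • x - A ⟨x, hx⟩) = (w - c) • P x := by
      conv_lhs => rw [hPS]
      rw [smul_apply, mul_apply_eq_comp, hRw.leftInv ⟨x, hx⟩]
    have h2 : c • P x = P (A ⟨x, hx⟩) := by
      rw [map_sub, map_smul, sub_smul] at h1
      exact (sub_right_injective h1).symm
    have h3 := P.le_of_opNorm_le hbound (A ⟨x, hx⟩)
    rw [← h2, norm_smul, hcn] at h3
    rw [div_mul_eq_mul_div, le_div_iff₀ (abs_pos.mpr hμ), mul_comm]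
    exact h3

end SpectralDecomp
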